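/- Let d ≥ 1 be an integer, let C > 1 be a real number, and let ρ be a growth function satisfying x ≤ ρ(x) ≤ C·x^d for all x ≥ 1. Let m ≥ 1 and 0 ≤ k ≤ m be integers, and let σ ∈ {−1,1}^m satisfy |σ| = k and disc(σ) ≥ 0. Writing f_σ^ρ = (a,b), one has 0 ≤ b = 2k−m ≤ k and 0 ≤ a ≤ τ_{m−k}^ρ(k,k) ≤ (2C)^{(m−k)·d^{m−k}}·(2k)^{d^{m−k}}. -/

import Mathlib

open scoped BigOperators symmDiff
open Finset

attribute [local instance] Classical.propDecidable

namespace PaperTS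

noncomputable section

/-- The group `𝔽_p^n`, written additively. -/
abbrev Vec (p n : ℕ) := Fin n → ZMod p

/-- Dot product on `𝔽_p^n`. -/
def dot {p n : ℕ} (x y : Vec p n) : ZMod p := ∑ i, x i * y i

/-- A quadratic factor of complexity `(ℓ, q)` on `𝔽_p^n`: a set of `ℓ` linearly independent
vectors together with a set of `q` pairwise distinct symmetric matrices. -/
structure QuadFactor (p n ℓ q : ℕ) where
  L : Fin ℓ → Vec p n
  Q : Fin q → Matrix (Fin n) (Fin n) (ZMod p)
  linIndep : LinearIndependent (ZMod p) L
  symm : ∀ j, (Q j).IsSymm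
  inj : Function.Injective Q

/-- Labels of atoms of a quadratic factor of complexity `(ℓ, q)`. -/
abbrev Label (p ℓ q : ℕ) := (Fin ℓ → ZMod p) × (Fin q → ZMod p)

namespace QuadFactor

variable {p n ℓ q : ℕ}

/-- The linear form `β_L`. -/
def betaL (B : QuadFactor p n ℓ q) (x : Vec p n) : Fin ℓ → ZMod p :=
  fun i => dot x (B.L i)

/-- The bilinear form `β_Q`. -/
def betaQ (B : QuadFactor p n ℓ q) (x y : Vec p n) : Fin q → ZMod p :=
  fun j => dot x ((B.Q j).mulVec y)

/-- The labelling map `β_𝓑`. -/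
def betaB (B : QuadFactor p n ℓ q) (x : Vec p n) : Label p ℓ q :=
  (B.betaL x, B.betaQ x x)

/-- The atom of `B` with label `ab`. -/
def atom (B : QuadFactor p n ℓ q) (ab : Label p ℓ q) : Set (Vec p n) :=
  {x | B.betaB x = ab}

/-- The fibre `β_Q^{-1}(d) ⊆ G × G`. -/
def fibQ (B : QuadFactor p n ℓ q) (d : Fin q → ZMod p) : Set (Vec p n × Vec p n) :=
  {xy | B.betaQ xy.1 xy.2 = d}

/-- The rank of a quadratic factor: `n` if `q = 0`, and otherwise the minimal rank of a
nontrivial linear combination of the matrices. -/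
def rank (B : QuadFactor p n ℓ q) : ℕ :=
  if q = 0 then n
  else sInf ((fun c : Fin q → ZMod p => (∑ j, c j • B.Q j).rank) '' {c | c ≠ 0})

end QuadFactor

/-- Refinement of quadratic factors: every atom of `B'` is contained in an atom of `B`. -/
def Refines {p n ℓ' q' ℓ q : ℕ} (B' : QuadFactor p n ℓ' q') (B : QuadFactor p n ℓ q) : Prop :=
  ∀ ab' : Label p ℓ' q', ∃ ab : Label p ℓ q, B'.atom ab' ⊆ B.atom ab

/-- `Σ(d)` for a tuple of labels `d = (d_a, d_b, d_c, d_ab, d_ac, d_bc)`. -/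
def SigmaD {p ℓ q : ℕ} (da db dc : Label p ℓ q) (dab dac dbc : Fin q → ZMod p) :
    Label p ℓ q :=
  (da.1 + db.1 + dc.1, da.2 + db.2 + dc.2 + 2 • dab + 2 • dac + 2 • dbc)

/-- Real-valued indicator function of a set. -/
def ind1 {G : Type*} (S : Set G) : G → ℝ := S.indicator 1

/-- Density of `A` on `P`. -/
def density {G : Type*} (A P : Set G) : ℝ := ((A ∩ P).ncard : ℝ) / (P.ncard : ℝ)

/-- Sum of `g` over a set in a fintype. -/
def setSum {α : Type*} [Fintype α] (s : Set α) (g : α → ℝ) : ℝ :=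
  ∑ x ∈ Finset.univ.filter (fun x => x ∈ s), g x

/-- Average of `g` over a set in a fintype. -/
def expOver {α : Type*} [Fintype α] (s : Set α) (g : α → ℝ) : ℝ :=
  setSum s g / (s.ncard : ℝ)

/-- The normalized indicator `μ_Γ` of `Γ ⊆ G × G`. -/
def mu {G : Type*} [Fintype G] (Γ : Set (G × G)) (xy : G × G) : ℝ :=
  ((Fintype.card G : ℝ) ^ 2 / (Γ.ncard : ℝ)) * ind1 Γ xy

/-- The product of the 8 values of `f` on the cube generated by `x, h₁, h₂, h₃`. -/
def cubeProd {G : Type*} [AddCommGroup G] (f : G → ℝ) (x h₁ h₂ h₃ : G) : ℝ :=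
  f x * f (x + h₁) * f (x + h₂) * f (x + h₃) * f (x + h₁ + h₂) * f (x + h₁ + h₃) *
    f (x + h₂ + h₃) * f (x + h₁ + h₂ + h₃)

/-- The eighth power of the (unnormalized) `U³` norm. -/
def U3pow8 {G : Type*} [AddCommGroup G] [Fintype G] (f : G → ℝ) : ℝ :=
  ∑ x : G, ∑ h₁ : G, ∑ h₂ : G, ∑ h₃ : G, cubeProd f x h₁ h₂ h₃

/-- The (unnormalized) `U³` norm. -/
def U3norm {G : Type*} [AddCommGroup G] [Fintype G] (f : G → ℝ) : ℝ :=
  U3pow8 f ^ ((1 : ℝ) / 8)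

/-- The Prendiville local `U³` norm of `f` relative to the set `B`
(equal to `0` when `‖1_B‖_{U³} = 0`, by the division-by-zero convention). -/
def U3localP {G : Type*} [AddCommGroup G] [Fintype G] (f : G → ℝ) (B : Set G) : ℝ :=
  U3norm (fun x => f x * ind1 B x) / U3norm (ind1 B)

/-- `Ω_B`: the 4-tuples all of whose associated cube points lie in `B`. -/
def Omega {G : Type*} [AddCommGroup G] (B : Set G) : Set (G × G × G × G) :=
  fun t =>
    match t with
    | (x, h₁, h₂, h₃) =>
        x ∈ B ∧ x + h₁ ∈ B ∧ x + h₂ ∈ B ∧ x + h₃ ∈ B ∧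
        x + h₁ + h₂ ∈ B ∧ x + h₁ + h₃ ∈ B ∧ x + h₂ + h₃ ∈ B ∧ x + h₁ + h₂ + h₃ ∈ B

/-- The change of variables `Ψ : G⁶ → G⁴`. -/
def Psi {G : Type*} [AddCommGroup G] : G × G × G × G × G × G → G × G × G × G :=
  fun t =>
    match t with
    | (x₁, x₂, y₁, y₂, z₁, z₂) => (x₁ + y₁ + z₁, x₂ - x₁, y₂ - y₁, z₂ - z₁)

/-- `K_{2,2,2}(d)`. -/
def K222 {p n ℓ q : ℕ} (B : QuadFactor p n ℓ q) (da db dc : Label p ℓ q)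
    (dab dac dbc : Fin q → ZMod p) :
    Set (Vec p n × Vec p n × Vec p n × Vec p n × Vec p n × Vec p n) :=
  fun t =>
    match t with
    | (x₁, x₂, y₁, y₂, z₁, z₂) =>
        B.betaB x₁ = da ∧ B.betaB x₂ = da ∧ B.betaB y₁ = db ∧ B.betaB y₂ = db ∧
        B.betaB z₁ = dc ∧ B.betaB z₂ = dc ∧
        B.betaQ x₁ y₁ = dab ∧ B.betaQ x₁ y₂ = dab ∧ B.betaQ x₂ y₁ = dab ∧ B.betaQ x₂ y₂ = dab ∧
        B.betaQ x₁ z₁ = dac ∧ B.betaQ x₁ z₂ = dac ∧ B.betaQ x₂ z₁ = dac ∧ B.betaQ x₂ z₂ = dac ∧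
        B.betaQ y₁ z₁ = dbc ∧ B.betaQ y₁ z₂ = dbc ∧ B.betaQ y₂ z₁ = dbc ∧ B.betaQ y₂ z₂ = dbc

/-- The product `∏_{i,j,k ∈ {1,2}} f (x_i + y_j + z_k)` for a 6-tuple. -/
def prod8 {G : Type*} [AddCommGroup G] (f : G → ℝ) :
    G × G × G × G × G × G → ℝ :=
  fun t =>
    match t with
    | (x₁, x₂, y₁, y₂, z₁, z₂) =>
        f (x₁ + y₁ + z₁) * f (x₁ + y₁ + z₂) * f (x₁ + y₂ + z₁) * f (x₁ + y₂ + z₂) *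
        f (x₂ + y₁ + z₁) * f (x₂ + y₁ + z₂) * f (x₂ + y₂ + z₁) * f (x₂ + y₂ + z₂)

/-- The eighth power of the Terry–Wolf local `U³` norm. -/
def TW8 {p n ℓ q : ℕ} [NeZero p] (B : QuadFactor p n ℓ q) (f : Vec p n → ℝ)
    (da db dc : Label p ℓ q) (dab dac dbc : Fin q → ZMod p) : ℝ :=
  expOver (B.atom da) fun x₀ => expOver (B.atom da) fun x₁ =>
  expOver (B.atom db) fun y₀ => expOver (B.atom db) fun y₁ =>
  expOver (B.atom dc) fun z₀ => expOver (B.atom dc) fun z₁ =>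
    (mu (B.fibQ dab) (x₀, y₀) * mu (B.fibQ dab) (x₀, y₁) *
     mu (B.fibQ dab) (x₁, y₀) * mu (B.fibQ dab) (x₁, y₁) *
     mu (B.fibQ dac) (x₀, z₀) * mu (B.fibQ dac) (x₀, z₁) *
     mu (B.fibQ dac) (x₁, z₀) * mu (B.fibQ dac) (x₁, z₁) *
     mu (B.fibQ dbc) (y₀, z₀) * mu (B.fibQ dbc) (y₀, z₁) *
     mu (B.fibQ dbc) (y₁, z₀) * mu (B.fibQ dbc) (y₁, z₁)) *
    prod8 f (x₀, x₁, y₀, y₁, z₀, z₁)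

/-- `A` has VC₂-dimension at least `k`. -/
def HasVC2Dim {G : Type*} [AddCommGroup G] (A : Set G) (k : ℕ) : Prop :=
  ∃ (a b : Fin k → G) (c : Set (Fin k × Fin k) → G),
    ∀ (i j : Fin k) (S : Set (Fin k × Fin k)), (a i + b j + c S ∈ A ↔ (i, j) ∈ S)

/-- `A` has VC₂-dimension at most `k`. -/
def VC2dimLE {G : Type*} [AddCommGroup G] (A : Set G) (k : ℕ) : Prop :=
  ∀ m : ℕ, HasVC2Dim A m → m ≤ k

/-- A growth function: an increasing function `ℝ → ℝ≥0`. -/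
def GrowthFunction (ρ : ℝ → ℝ) : Prop :=
  Monotone ρ ∧ ∀ x, 0 ≤ ρ x

/-- `ρ` is bounded by a polynomial of degree `d` on `[1, ∞)`. -/
def PolyBound (ρ : ℝ → ℝ) (d : ℕ) : Prop :=
  ∃ C > (0 : ℝ), ∀ x : ℝ, 1 ≤ x → ρ x ≤ C * x ^ d

/-- `ρ` is a polynomial growth function of degree (exactly) `d`, i.e. `d ≥ 1` is minimal
with `ρ(x) ≤ C x^d` for `x ≥ 1`. -/
def PolyGrowthDegree (ρ : ℝ → ℝ) (d : ℕ) : Prop :=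
  1 ≤ d ∧ PolyBound ρ d ∧ ∀ d' : ℕ, 1 ≤ d' → PolyBound ρ d' → d ≤ d'

/-- The index `ind(A, 𝒫)` of a partition. -/
def indx {p n : ℕ} (A : Set (Vec p n)) (Ps : Finset (Set (Vec p n))) : ℝ :=
  (∑ P ∈ Ps, density A P ^ 2 * (P.ncard : ℝ)) / (p : ℝ) ^ n

/-- `P` fails to be `δ`-uniform for `A` with respect to the localized `U³` norm. -/
def BadPart {G : Type*} [AddCommGroup G] [Fintype G] (δ : ℝ) (A P : Set G) : Prop :=
  δ * U3norm (ind1 P) < U3norm (fun x => (ind1 A x - density A P) * ind1 P x)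

/-- `ker(U)^⊥`, the orthogonal complement of the kernel of `U`. -/
def kerPerp {p n : ℕ} (U : Matrix (Fin n) (Fin n) (ZMod p)) : Set (Vec p n) :=
  {v | ∀ w : Vec p n, U.mulVec w = 0 → dot v w = 0}

/-- `B'` is a `ρ`-matrix deletion of `B`. -/
def IsMatrixDeletion {p n ℓ' q' ℓ q : ℕ} (ρ : ℝ → ℝ)
    (B' : QuadFactor p n ℓ' q') (B : QuadFactor p n ℓ q) : Prop :=
  q' + 1 = q ∧
  ∃ c : Fin q → ZMod p, c ≠ 0 ∧
    (((∑ j, c j • B.Q j).rank : ℝ) < ρ ((ℓ : ℝ) + (q : ℝ))) ∧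
    (∃ i : Fin q, c i ≠ 0 ∧ Set.range B'.Q = Set.range B.Q \ {B.Q i}) ∧
    Set.range B.L ⊆ Set.range B'.L ∧
    Submodule.span (ZMod p) (Set.range B'.L) =
      Submodule.span (ZMod p) (Set.range B.L ∪ kerPerp (∑ j, c j • B.Q j))

/-- The functions `τ_i^ρ : ℤ × ℤ → ℝ`. -/
def tau (ρ : ℝ → ℝ) : ℕ → ℤ × ℤ → ℝ
  | 0, xy => (xy.1 : ℝ)
  | i + 1, xy => tau ρ i xy + ρ (tau ρ i xy + (xy.2 : ℝ) - (i : ℝ))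

/-- `f_σ^ρ` for binary strings `σ : Fin m → ℤ` (with values in `{-1, 1}`). -/
def fseq (ρ : ℝ → ℝ) : (m : ℕ) → (Fin m → ℤ) → ℝ × ℝ
  | 0, _ => (0, 0)
  | m + 1, σ =>
      let ab := fseq ρ m (fun j => σ j.castSucc)
      if σ (Fin.last m) = 1 then (ab.1 + 1, ab.2 + 1)
      else (ab.1 + ρ (ab.1 + ab.2), ab.2 - 1)

end

theorem fseq_snd (ρ : ℝ → ℝ) (m : ℕ) (σ : Fin m → ℤ) (hσ : ∀ j, σ j = 1 ∨ σ j = -1) :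
    (fseq ρ m σ).2 = ((∑ j, σ j : ℤ) : ℝ) := by
  induction m with
  | zero => simp [fseq]
  | succ m ih =>
    have h := ih (fun j => σ j.castSucc) (fun j => hσ _)
    rw [Fin.sum_univ_castSucc]
    rcases hσ (Fin.last m) with h1 | h1
    · simp [fseq, h1, h]
    · simp [fseq, h1, h, sub_eq_add_neg]

theorem sum_signs_eq (m : ℕ) (σ : Fin m → ℤ) (hσ : ∀ j, σ j = 1 ∨ σ j = -1) :
    ∑ j, σ j = 2 * ((Finset.univ.filter fun j => σ j = 1).card : ℤ) - m := by
  have h : ∀ j, σ j = 2 * (if σ j = 1 then 1 else 0) - 1 := by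
    intro j
    rcases hσ j with h | h <;> simp [h]
  rw [Finset.sum_congr rfl fun j _ => h j, Finset.sum_sub_distrib, ← Finset.mul_sum,
    Finset.sum_boole]
  simp

theorem fseq_fst_nonneg {ρ : ℝ → ℝ} (hρ : GrowthFunction ρ) (m : ℕ) (σ : Fin m → ℤ) :
    0 ≤ (fseq ρ m σ).1 := by
  induction m with
  | zero => simp [fseq]
  | succ m ih =>
    have h := ih fun j => σ j.castSucc
    simp only [fseq]
    split_ifs
    · dsimp only
      linarith
    · exact add_nonneg h (hρ.2 _)

theorem tau_add_one_le {ρ : ℝ → ℝ} (hρ : GrowthFunction ρ) (x y : ℤ) (i : ℕ) :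
    tau ρ i (x, y) + 1 ≤ tau ρ i (x + 1, y + 1) := by
  induction i with
  | zero => simp [tau]
  | succ i ih =>
    have h : ρ (tau ρ i (x, y) + (y : ℝ) - i) ≤
        ρ (tau ρ i (x + 1, y + 1) + ((y + 1 : ℤ) : ℝ) - i) := by
      apply hρ.1
      push_cast
      linarith
    simp only [tau]
    linarith

/-- The first coordinate of `fseq` is largest when all the ones come first. -/
theorem fseq_fst_le_tau {ρ : ℝ → ℝ} (hρ : GrowthFunction ρ) (m : ℕ) (σ : Fin m → ℤ)
    (hσ : ∀ j, σ j = 1 ∨ σ j = -1) (k i : ℕ)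
    (hk : (Finset.univ.filter fun j => σ j = 1).card = k) (hi : k + i = m) :
    (fseq ρ m σ).1 ≤ tau ρ i ((k : ℤ), (k : ℤ)) := by
  induction m generalizing k i with
  | zero =>
    obtain ⟨rfl, rfl⟩ : k = 0 ∧ i = 0 := by omega
    simp [fseq, tau]
  | succ m ih =>
    set σ' : Fin m → ℤ := fun j => σ j.castSucc with hdef
    have hσ' : ∀ j, σ' j = 1 ∨ σ' j = -1 := fun j => hσ _
    have hs : ∑ j, σ j = ∑ j, σ' j + σ (Fin.last m) := Fin.sum_univ_castSucc σ
    rw [sum_signs_eq _ _ hσ, sum_signs_eq _ _ hσ', hk] at hs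
    push_cast at hs
    rcases hσ (Fin.last m) with h1 | h1
    · rw [h1] at hs
      obtain ⟨k, rfl⟩ : ∃ k', k = k' + 1 := ⟨k - 1, by omega⟩
      have h := ih σ' hσ' k i (by push_cast at hs; omega) (by omega)
      have ht := tau_add_one_le hρ k k i
      simp only [fseq, h1, if_true]
      push_cast
      linarith
    · rw [h1] at hs
      have hc : (Finset.univ.filter fun j => σ' j = 1).card = k := by omega
      have hle : k ≤ m := by simpa [hc] using Finset.card_filter_le univ fun j => σ' j = 1
      obtain ⟨i, rfl⟩ : ∃ i', i = i' + 1 := ⟨i - 1, by omega⟩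
      have h := ih σ' hσ' k i hc (by omega)
      have hb : (fseq ρ m σ').2 = (k : ℝ) - i := by
        rw [fseq_snd ρ m σ' hσ', sum_signs_eq m σ' hσ', hc, show m = k + i by omega]
        push_cast
        ring
      have hr : ρ ((fseq ρ m σ').1 + (fseq ρ m σ').2) ≤
          ρ (tau ρ i ((k : ℤ), (k : ℤ)) + ((k : ℤ) : ℝ) - i) := by
        apply hρ.1
        rw [hb]
        push_cast
        linarith
      have hne : ¬ (-1 : ℤ) = 1 := by norm_num
      simp only [fseq, h1, if_neg hne, tau]
      exact add_le_add h hr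

theorem le_tau {ρ : ℝ → ℝ} (hρ : GrowthFunction ρ) (x y : ℤ) (i : ℕ) :
    (x : ℝ) ≤ tau ρ i (x, y) := by
  induction i with
  | zero => simp [tau]
  | succ i ih => exact ih.trans (le_add_of_nonneg_right (hρ.2 _))

theorem tau_add_le {ρ : ℝ → ℝ} (hρ : GrowthFunction ρ) {d : ℕ} (hd : 1 ≤ d) {C : ℝ}
    (hC : 1 ≤ C) (hb : ∀ x : ℝ, 1 ≤ x → ρ x ≤ C * x ^ d) {k : ℕ} (hk : 1 ≤ k) (i : ℕ) :
    tau ρ i ((k : ℤ), (k : ℤ)) + k ≤ (2 * C) ^ (i * d ^ i) * (2 * (k : ℝ)) ^ (d ^ i) := by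
  induction i with
  | zero =>
    simp only [tau]
    norm_num
    linarith
  | succ i ih =>
    have hk' : (1 : ℝ) ≤ k := by exact_mod_cast hk
    have h0 := le_tau hρ k k i
    push_cast at h0
    set T := tau ρ i ((k : ℤ), (k : ℤ)) with hT
    have h1 : 1 ≤ T + k := by linarith
    have hr : ρ (T + ((k : ℤ) : ℝ) - i) ≤ C * (T + k) ^ d := by
      refine (hρ.1 ?_).trans (hb _ h1)
      push_cast
      linarith [(Nat.cast_nonneg i : (0 : ℝ) ≤ i)]
    have hp : T + k ≤ C * (T + k) ^ d :=
      (le_self_pow₀ h1 (by omega)).trans (le_mul_of_one_le_left (by positivity) hC)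
    calc tau ρ (i + 1) ((k : ℤ), (k : ℤ)) + k
        = T + k + ρ (T + ((k : ℤ) : ℝ) - i) := by
          simp only [tau, ← hT]
          ring
      _ ≤ 2 * C * (T + k) ^ d := by linarith
      _ ≤ 2 * C * ((2 * C) ^ (i * d ^ i) * (2 * (k : ℝ)) ^ (d ^ i)) ^ d := by gcongr
      _ = (2 * C) ^ (1 + i * d ^ (i + 1)) * (2 * (k : ℝ)) ^ (d ^ (i + 1)) := by
          rw [mul_pow, ← pow_mul, ← pow_mul, pow_add, pow_succ d i, mul_assoc i]
          ring
      _ ≤ (2 * C) ^ ((i + 1) * d ^ (i + 1)) * (2 * (k : ℝ)) ^ (d ^ (i + 1)) := by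
          gcongr
          · linarith
          · have := Nat.one_le_pow (i + 1) d hd
            linarith

theorem statement18 (d : ℕ) (hd : 1 ≤ d) (C : ℝ) (hC : 1 < C)
    (ρ : ℝ → ℝ) (hρ : GrowthFunction ρ)
    (hbounds : ∀ x : ℝ, 1 ≤ x → x ≤ ρ x ∧ ρ x ≤ C * x ^ d)
    (m k : ℕ) (hm : 1 ≤ m) (hk : k ≤ m)
    (σ : Fin m → ℤ) (hσ : ∀ j, σ j = 1 ∨ σ j = -1)
    (hcount : (Finset.univ.filter fun j => σ j = 1).card = k)
    (hdisc : 0 ≤ ∑ j, σ j) :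
    (fseq ρ m σ).2 = 2 * (k : ℝ) - (m : ℝ) ∧
    0 ≤ (fseq ρ m σ).2 ∧ (fseq ρ m σ).2 ≤ (k : ℝ) ∧
    0 ≤ (fseq ρ m σ).1 ∧
    (fseq ρ m σ).1 ≤ tau ρ (m - k) ((k : ℤ), (k : ℤ)) ∧
    tau ρ (m - k) ((k : ℤ), (k : ℤ)) ≤
      (2 * C) ^ ((m - k) * d ^ (m - k)) * (2 * (k : ℝ)) ^ (d ^ (m - k)) := by
  have hsum : ∑ j, σ j = 2 * (k : ℤ) - m := by
    rw [sum_signs_eq m σ hσ, hcount]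
  have hsnd : (fseq ρ m σ).2 = 2 * (k : ℝ) - (m : ℝ) := by
    rw [fseq_snd ρ m σ hσ, hsum]
    push_cast
    ring
  have hk1 : 1 ≤ k := by omega
  have hkm : (k : ℝ) ≤ m := by exact_mod_cast hk
  have hmk : (m : ℝ) ≤ 2 * k := by exact_mod_cast (by omega : m ≤ 2 * k)
  refine ⟨hsnd, by linarith, by linarith, fseq_fst_nonneg hρ m σ,
    fseq_fst_le_tau hρ m σ hσ k (m - k) hcount (by omega), ?_⟩
  have h := tau_add_le hρ hd hC.le (fun x hx => (hbounds x hx).2) hk1 (m - k)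
  linarith [(Nat.cast_nonneg k : (0 : ℝ) ≤ k)]

end PaperTS
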